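/- arXiv:1804.03552 — 4 statements merged into one kernel-verified Lean document; each statement's English description precedes it below -/
import Mathlib

section
/- Let A = (a_{ij}) ∈ ℕ^{m×m} satisfy (1) weak symmetry: a_{ij} = 0 if and only if a_{ji} = 0 for all i, j; and (2) consistency: for any pairwise distinct indices n_1, …, n_t in {1, …, m} with t ≥ 2, a_{n_1,n_2} a_{n_2,n_3} ⋯ a_{n_{t-1},n_t} a_{n_t,n_1} = a_{n_2,n_1} a_{n_3,n_2} ⋯ a_{n_t,n_{t-1}} a_{n_1,n_t}. Then there exists a finite simple graph G admitting a perfect m-coloring whose color adjacency matrix is A. -/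
namespace SimpleGraph.Walk

variable {V : Type*} {G : SimpleGraph V}

/-- The product of the values of `f` along the darts of a walk. -/
def dartProd (f : V → V → ℚ) : {u v : V} → G.Walk u v → ℚ
  | _, _, nil => 1
  | _, _, cons (u := u) (v := v) _ p => f u v * dartProd f p

theorem dartProd_append (f : V → V → ℚ) {u v w : V} (p : G.Walk u v) (q : G.Walk v w) :
    (p.append q).dartProd f = p.dartProd f * q.dartProd f := by
  induction p with
  | nil => simp [dartProd]
  | cons h p ih => simp [dartProd, ih, mul_assoc]

theorem dartProd_pos {f : V → V → ℚ} (hf : ∀ u v, G.Adj u v → 0 < f u v) {u v : V}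
    (p : G.Walk u v) : 0 < p.dartProd f := by
  induction p with
  | nil => simp [dartProd]
  | cons h p ih => exact mul_pos (hf _ _ h) ih

theorem dartProd_mul_dartProd_reverse {f : V → V → ℚ}
    (hf : ∀ u v, G.Adj u v → f u v * f v u = 1) {u v : V} (p : G.Walk u v) :
    p.dartProd f * p.reverse.dartProd f = 1 := by
  induction p with
  | nil => simp [dartProd]
  | @cons a b c h p ih =>
    simp only [reverse_cons, dartProd_append, dartProd, mul_one]
    linear_combination (f a b * f b a) * ih + hf a b h

theorem dartProd_eq_prod_getVert (f : V → V → ℚ) {u v : V} (p : G.Walk u v) :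
    p.dartProd f = ∏ s ∈ Finset.range p.length, f (p.getVert s) (p.getVert (s + 1)) := by
  induction p with
  | nil => simp [dartProd]
  | cons h p ih => simp [dartProd, ih, Finset.prod_range_succ', mul_comm]

theorem dartProd_bypass [DecidableEq V] {f : V → V → ℚ}
    (hcyc : ∀ u v (p : G.Walk v u), G.Adj u v → p.IsPath → f u v * p.dartProd f = 1)
    {u v : V} (p : G.Walk u v) : p.bypass.dartProd f = p.dartProd f := by
  induction p with
  | nil => rfl
  | @cons a b c h p ih =>
    simp only [bypass, dartProd, ← ih]
    split_ifs with hs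
    · have h1 := hcyc a b (p.bypass.takeUntil a hs) h (p.bypass_isPath.takeUntil hs)
      conv_rhs => rw [← p.bypass.take_spec hs, dartProd_append, ← mul_assoc, h1, one_mul]
    · rfl

theorem dartProd_closed {f : V → V → ℚ}
    (hcyc : ∀ u v (p : G.Walk v u), G.Adj u v → p.IsPath → f u v * p.dartProd f = 1)
    {u : V} (p : G.Walk u u) : p.dartProd f = 1 := by
  classical
  rw [← dartProd_bypass hcyc, (isPath_iff_nil.1 p.bypass_isPath).eq_nil]
  rfl

end SimpleGraph.Walk

/-- A positive multiplicative weight on darts which is trivial on cycles is a quotient of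
vertex weights. -/
theorem SimpleGraph.exists_potential {V : Type*} (G : SimpleGraph V) {f : V → V → ℚ}
    (hpos : ∀ u v, G.Adj u v → 0 < f u v)
    (hinv : ∀ u v, G.Adj u v → f u v * f v u = 1)
    (hcyc : ∀ u v (p : G.Walk v u), G.Adj u v → p.IsPath → f u v * p.dartProd f = 1) :
    ∃ w : V → ℚ, (∀ v, 0 < w v) ∧ ∀ u v, G.Adj u v → w v = w u * f u v := by
  have hr (v : V) : G.Reachable (G.connectedComponentMk v).out v :=
    ConnectedComponent.exact (Quot.out_eq _)
  have key (r u v : V) (p : G.Walk r u) (q : G.Walk r v) (h : G.Adj u v) :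
      q.dartProd f = p.dartProd f * f u v := by
    have h1 := Walk.dartProd_closed hcyc (p.append (.cons h q.reverse))
    rw [Walk.dartProd_append, Walk.dartProd] at h1
    have h2 := Walk.dartProd_mul_dartProd_reverse hinv q
    linear_combination (p.dartProd f * f u v) * h2 - q.dartProd f * h1
  refine ⟨fun v => (hr v).some.dartProd f, fun v => Walk.dartProd_pos hpos _, fun u v h => ?_⟩
  have e : G.connectedComponentMk u = G.connectedComponentMk v :=
    ConnectedComponent.sound h.reachable
  have aux (r r' : V) (e : r = r') (p : G.Walk r u) (q : G.Walk r' v) :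
      q.dartProd f = p.dartProd f * f u v := by
    subst e
    exact key _ _ _ p q h
  exact aux _ _ (by rw [e]) _ _

theorem exists_nat_weights {ι : Type*} [Fintype ι] (w : ι → ℚ) (hw : ∀ i, 0 < w i) :
    ∃ (W : ι → ℕ) (D : ℚ), (∀ i, 0 < W i) ∧ ∀ i, (W i : ℚ) = w i * D := by
  have hD : 0 < ∏ j, (w j).den := Finset.prod_pos fun j _ => (w j).den_pos
  have hex (i : ι) : ∃ n : ℕ, (n : ℚ) = w i * ((∏ j, (w j).den : ℕ) : ℚ) := by
    obtain ⟨k, hk⟩ := Finset.dvd_prod_of_mem (fun j => (w j).den) (Finset.mem_univ i)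
    refine ⟨(w i).num.toNat * k, ?_⟩
    have hn : (((w i).num.toNat : ℤ) : ℚ) = (w i).num := by
      rw [Int.toNat_of_nonneg (Rat.num_nonneg.2 (hw i).le)]
    rw [hk]
    push_cast at hn ⊢
    rw [hn, ← mul_assoc, Rat.mul_den_eq_num]
  choose W hW using hex
  refine ⟨W, _, fun i => ?_, hW⟩
  have : (0 : ℚ) < W i := by
    rw [hW]
    exact mul_pos (hw i) (by exact_mod_cast hD)
  exact_mod_cast this

theorem exists_balanced_weights (m : ℕ) (A : Matrix (Fin m) (Fin m) ℕ)
    (hsym : ∀ i j, A i j = 0 ↔ A j i = 0)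
    (hcons : ∀ t, 2 ≤ t → ∀ n : ℕ → Fin m, (∀ i < t, ∀ j < t, n i = n j → i = j) →
      (∏ s ∈ Finset.range (t - 1), A (n s) (n (s + 1))) * A (n (t - 1)) (n 0)
        = (∏ s ∈ Finset.range (t - 1), A (n (s + 1)) (n s)) * A (n 0) (n (t - 1))) :
    ∃ w : Fin m → ℕ, (∀ i, 0 < w i) ∧ ∀ i j, w i * A i j = w j * A j i := by
  let G : SimpleGraph (Fin m) :=
    { Adj := fun i j => i ≠ j ∧ A i j ≠ 0
      symm := ⟨fun i j h => ⟨h.1.symm, fun h0 => h.2 ((hsym i j).2 h0)⟩⟩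
      loopless := ⟨fun i h => h.1 rfl⟩ }
  have hne {i j} (h : G.Adj i j) : (A i j : ℚ) ≠ 0 := by exact_mod_cast h.2
  let f : Fin m → Fin m → ℚ := fun i j => A i j / A j i
  obtain ⟨w, hw, hwf⟩ := G.exists_potential (f := f)
    (fun u v h => div_pos (by have := hne h; positivity) (by have := hne h.symm; positivity))
    (fun u v h => by
      have := hne h
      have := hne h.symm
      simp only [f]
      field_simp)
    (fun u v p h hp => by
      have hl : 1 ≤ p.length := by
        by_contra h0
        exact h.ne (SimpleGraph.Walk.eq_of_length_eq_zero (p := p) (by omega)).symm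
      have hc := hcons (p.length + 1) (by omega) p.getVert (fun i hi j hj hij =>
        hp.getVert_injOn (by simp; omega) (by simp; omega) hij)
      simp only [Nat.add_sub_cancel, SimpleGraph.Walk.getVert_length,
        SimpleGraph.Walk.getVert_zero] at hc
      have hc' := congrArg (Nat.cast : ℕ → ℚ) hc
      push_cast at hc'
      have h2 : ∏ s ∈ Finset.range p.length, (A (p.getVert (s + 1)) (p.getVert s) : ℚ) ≠ 0 :=
        Finset.prod_ne_zero_iff.2 fun s hs =>
          hne (p.adj_getVert_succ (Finset.mem_range.1 hs)).symm
      have h3 := hne h.symm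
      simp only [SimpleGraph.Walk.dartProd_eq_prod_getVert, f, Finset.prod_div_distrib]
      field_simp
      linear_combination hc')
  obtain ⟨W, D, hW, hWD⟩ := exists_nat_weights w hw
  refine ⟨W, hW, fun i j => ?_⟩
  by_cases hij : i = j
  · rw [hij]
  by_cases h0 : A i j = 0
  · rw [h0, (hsym i j).1 h0, mul_zero, mul_zero]
  have h : G.Adj i j := ⟨hij, h0⟩
  have h1 := hne h.symm
  have : (W i * A i j : ℚ) = W j * A j i := by
    rw [hWD, hWD, hwf i j h]
    simp only [f]
    field_simp
  exact_mod_cast this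

theorem ncard_lt_mul_mod_eq {w a x : ℕ} (hx : x < w) :
    {e : ℕ | e < w * a ∧ e % w = x}.ncard = a := by
  have : {e : ℕ | e < w * a ∧ e % w = x} = (fun q => x + w * q) '' (Finset.range a : Set ℕ) := by
    ext e
    simp only [Set.mem_ofPred_eq, Set.mem_image, Finset.coe_range, Set.mem_Iio]
    constructor
    · rintro ⟨h1, h2⟩
      exact ⟨e / w, Nat.div_lt_of_lt_mul h1, by rw [← h2, Nat.mod_add_div]⟩
    · rintro ⟨q, hq, rfl⟩
      refine ⟨?_, by rw [Nat.add_mul_mod_self_left, Nat.mod_eq_of_lt hx]⟩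
      calc x + w * q < w * (q + 1) := by rw [mul_add, mul_one]; omega
        _ ≤ w * a := Nat.mul_le_mul_left _ hq
  rw [this, Set.ncard_image_of_injective, Set.ncard_coe_finset, Finset.card_range]
  intro p q h
  exact Nat.eq_of_mul_eq_mul_left (by omega) (Nat.add_left_cancel h)

/-- Vertices of the realizing graph: a color `i`, a position below `w i`, a voltage in `ZMod K`
and a side of the bipartition. -/
abbrev LiftVertex {m : ℕ} (w : Fin m → ℕ) (K : ℕ) : Type :=
  Σ i : Fin m, Fin (w i) × ZMod K × Bool

/-- The arc relation of the realizing graph, from the `false` side to the `true` side. The arcs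
from color `i` to color `j` are labelled by `e < w i * A i j`; the label determines the two
positions modulo `w i` and `w j`, and is the voltage of the arc. -/
def LiftArc {m : ℕ} (A : Matrix (Fin m) (Fin m) ℕ) (w : Fin m → ℕ) (K : ℕ)
    (u v : LiftVertex w K) : Prop :=
  u.2.2.2 = false ∧ v.2.2.2 = true ∧ ∃ e : ℕ, e < w u.1 * A u.1 v.1 ∧
    e % w u.1 = u.2.1 ∧ e % w v.1 = v.2.1 ∧ v.2.2.1 = u.2.2.1 + e

/-- The graph realizing a balanced matrix. -/
def liftGraph {m : ℕ} (A : Matrix (Fin m) (Fin m) ℕ) (w : Fin m → ℕ) (K : ℕ) :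
    SimpleGraph (LiftVertex w K) where
  Adj u v := LiftArc A w K u v ∨ LiftArc A w K v u
  symm := ⟨fun _ _ h => h.symm⟩
  loopless := ⟨fun u h => by
    rcases h with h | h <;> exact absurd (h.1.symm.trans h.2.1) (by decide)⟩

theorem ncard_liftGraph_neighbors {m : ℕ} (A : Matrix (Fin m) (Fin m) ℕ) {w : Fin m → ℕ} {K : ℕ}
    (hw : ∀ i, 0 < w i) (hbal : ∀ i j, w i * A i j = w j * A j i)
    (hK : ∀ i j, w i * A i j ≤ K) (u : LiftVertex w K) (j : Fin m) :
    {v | (liftGraph A w K).Adj u v ∧ v.1 = j}.ncard = A u.1 j := by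
  obtain ⟨i, x, k, b⟩ := u
  have hcast {e e' : ℕ} (h : e < w i * A i j) (h' : e' < w i * A i j)
      (he : (e : ZMod K) = e') : e = e' := by
    have := hK i j
    rw [ZMod.natCast_eq_natCast_iff'] at he
    rwa [Nat.mod_eq_of_lt (by omega), Nat.mod_eq_of_lt (by omega)] at he
  let g : ℕ → LiftVertex w K := fun e =>
    ⟨j, ⟨e % w j, Nat.mod_lt _ (hw j)⟩, if b then k - e else k + e, !b⟩
  have himg : {v | (liftGraph A w K).Adj ⟨i, x, k, b⟩ v ∧ v.1 = j} =
      g '' {e : ℕ | e < w i * A i j ∧ e % w i = x} := by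
    ext v
    simp only [Set.mem_ofPred_eq, Set.mem_image]
    constructor
    · obtain ⟨j', y, l, b'⟩ := v
      rintro ⟨h, rfl⟩
      rcases h with ⟨h1, h2, e, he, hx, hy, hl⟩ | ⟨h1, h2, e, he, hx, hy, hl⟩
      · dsimp only at h1 h2 he hx hy hl
        subst h1 h2 hl
        exact ⟨e, ⟨he, hx⟩, by simp [g, hy]⟩
      · dsimp only at h1 h2 he hx hy hl
        subst h1 h2 hl
        exact ⟨e, ⟨hbal i j' ▸ he, hy⟩, by simp [g, hx]⟩
    · rintro ⟨e, ⟨he, hx⟩, rfl⟩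
      refine ⟨?_, rfl⟩
      cases b
      · exact Or.inl ⟨rfl, rfl, e, he, hx, rfl, by simp [g]⟩
      · exact Or.inr ⟨rfl, rfl, e, (hbal i j).symm ▸ he, rfl, hx, by simp [g]⟩
  rw [himg, Set.InjOn.ncard_image, ncard_lt_mul_mod_eq x.2]
  intro e he e' he' h
  refine hcast he.1 he'.1 ?_
  have h' : (if b then k - e else k + e : ZMod K) = if b then k - e' else k + e' := by
    simp only [g, Sigma.mk.injEq, heq_eq_eq, Prod.mk.injEq, true_and] at h
    exact h.2.1
  cases b <;> simpa using h'

/-- Any weakly symmetric matrix `A ∈ ℕ^{m×m}` satisfying the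
consistency condition is the color adjacency matrix of a perfect `m`-coloring
of some finite simple graph. -/
theorem stmt_4 (m : ℕ) (A : Matrix (Fin m) (Fin m) ℕ)
    (hsym : ∀ i j, A i j = 0 ↔ A j i = 0)
    (hcons : ∀ t, 2 ≤ t → ∀ n : ℕ → Fin m, (∀ i < t, ∀ j < t, n i = n j → i = j) →
      (∏ s ∈ Finset.range (t - 1), A (n s) (n (s + 1))) * A (n (t - 1)) (n 0)
        = (∏ s ∈ Finset.range (t - 1), A (n (s + 1)) (n s)) * A (n 0) (n (t - 1))) :
    ∃ (N : ℕ) (G : SimpleGraph (Fin N)) (c : Fin N → Fin m),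
      Function.Surjective c ∧
      ∀ (v : Fin N) (j : Fin m), Nat.card {u | G.Adj v u ∧ c u = j} = A (c v) j := by
  obtain ⟨w, hw, hbal⟩ := exists_balanced_weights m A hsym hcons
  let K : ℕ := (∑ i, ∑ j, w i * A i j) + 1
  have hK (i j : Fin m) : w i * A i j ≤ K :=
    calc w i * A i j ≤ ∑ j, w i * A i j :=
          Finset.single_le_sum (f := fun j => w i * A i j) (fun _ _ => Nat.zero_le _)
            (Finset.mem_univ j)
      _ ≤ ∑ i, ∑ j, w i * A i j :=
          Finset.single_le_sum (f := fun i => ∑ j, w i * A i j) (fun _ _ => Nat.zero_le _)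
            (Finset.mem_univ i)
      _ ≤ K := Nat.le_succ _
  have : NeZero K := ⟨Nat.succ_ne_zero _⟩
  let φ := (Fintype.equivFin (LiftVertex w K)).symm
  refine ⟨_, (liftGraph A w K).comap φ, fun v => (φ v).1, fun i => ?_, fun v j => ?_⟩
  · exact ⟨φ.symm ⟨i, ⟨0, hw i⟩, 0, false⟩, by simp⟩
  · rw [← ncard_liftGraph_neighbors A hw hbal hK (φ v) j, Nat.card_coe_set_eq]
    exact Set.ncard_preimage_of_injective_subset_range
      (s := {u | (liftGraph A w K).Adj (φ v) u ∧ u.1 = j}) φ.injective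
      (by simp [φ.surjective.range_eq])
end

section
/- Let A = (a_{ij}) ∈ ℕ^{m×m}. There exists a finite connected simple graph G admitting a perfect m-coloring whose color adjacency matrix is A if and only if A satisfies (1) weak symmetry: a_{ij} = 0 iff a_{ji} = 0 for all i, j; (2) consistency: for any pairwise distinct indices n_1, …, n_t in {1, …, m} with t ≥ 2, a_{n_1,n_2} a_{n_2,n_3} ⋯ a_{n_{t-1},n_t} a_{n_t,n_1} = a_{n_2,n_1} a_{n_3,n_2} ⋯ a_{n_t,n_{t-1}} a_{n_1,n_t}; and (3) A is irreducible, i.e. A is not conjugate via a permutation matrix to a block diagonal matrix having more than one block. -/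
open Finset
open scoped NNRat

universe u

namespace SimpleGraph

variable {V W ι : Type*}

/-- `c` is a perfect coloring of `G` with color adjacency matrix `A`; empty color classes are
allowed. -/
def IsPerfectColoring (G : SimpleGraph V) (c : V → ι) (A : Matrix ι ι ℕ) : Prop :=
  ∀ v j, Nat.card {u | G.Adj v u ∧ c u = j} = A (c v) j

namespace IsPerfectColoring

variable {G : SimpleGraph V} {c : V → ι} {A : Matrix ι ι ℕ}

theorem card_mul_eq_card_mul [Fintype V] [DecidableEq ι] (h : G.IsPerfectColoring c A)
    (i j : ι) : #{v | c v = i} * A i j = #{v | c v = j} * A j i := by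
  classical
  have key (i j : ι) (v : V) (hv : c v = i) : #{u | c u = j ∧ G.Adj v u} = A i j := by
    rw [← hv, ← h v j, Nat.card_eq_fintype_card, ← Set.toFinset_card]
    congr 1
    ext u
    simp [and_comm]
  refine Finset.card_mul_eq_card_mul G.Adj (fun v hv ↦ ?_) (fun v hv ↦ ?_)
  · rw [bipartiteAbove, filter_filter]
    exact key i j v (by simpa using hv)
  · simp_rw [bipartiteBelow, filter_filter, G.adj_comm _ v]
    exact key j i v (by simpa using hv)

theorem exists_adj [Finite V] (h : G.IsPerfectColoring c A) {v : V} {j : ι} :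
    A (c v) j ≠ 0 ↔ ∃ u, G.Adj v u ∧ c u = j := by
  rw [← h v j, ← Nat.pos_iff_ne_zero, Finite.card_pos_iff, Set.nonempty_coe_sort]
  rfl

theorem comap_iso {H : SimpleGraph W} (e : H ≃g G) (h : G.IsPerfectColoring c A) :
    H.IsPerfectColoring (c ∘ e) A := fun v j ↦ by
  rw [Function.comp_apply, ← h (e v) j]
  exact Nat.card_congr (e.toEquiv.subtypeEquiv fun u ↦ by simp [← e.map_adj_iff])

theorem restrict_connectedComponent (h : G.IsPerfectColoring c A) (C : G.ConnectedComponent) :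
    C.toSimpleGraph.IsPerfectColoring (fun v ↦ c v) A := fun v j ↦ by
  rw [← h v j]
  refine Nat.card_congr ⟨fun u ↦ ⟨u.1, u.2⟩, fun u ↦ ⟨⟨u.1, ?_⟩, u.2⟩, fun _ ↦ rfl, fun _ ↦ rfl⟩
  exact C.mem_supp_of_adj_mem_supp v.2 u.2.1

end IsPerfectColoring

/-- The bipartite graph on two copies of `V` that joins `(x, false)` to `(y, true)` whenever
`R x y`. -/
def bipartiteCover (R : V → V → Prop) : SimpleGraph (V × Bool) where
  Adj p q := (p.2 = false ∧ q.2 = true ∧ R p.1 q.1) ∨ (p.2 = true ∧ q.2 = false ∧ R q.1 p.1)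
  symm := ⟨fun p q h ↦ by tauto⟩
  loopless := ⟨fun p h ↦ by grind⟩

theorem isPerfectColoring_bipartiteCover {R : V → V → Prop} {c : V → ι} {A : Matrix ι ι ℕ}
    (hl : ∀ v j, {u | R v u ∧ c u = j}.ncard = A (c v) j)
    (hr : ∀ v j, {u | R u v ∧ c u = j}.ncard = A (c v) j) :
    (bipartiteCover R).IsPerfectColoring (fun p ↦ c p.1) A := by
  rintro ⟨v, b⟩ j
  rw [Nat.card_coe_set_eq]
  cases b
  · rw [← hl v j,
      ← Set.ncard_image_of_injective {u | R v u ∧ c u = j} (Prod.mk_left_injective true)]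
    refine congrArg Set.ncard ?_
    ext ⟨u, b'⟩
    cases b' <;> simp [bipartiteCover]
  · rw [← hr v j,
      ← Set.ncard_image_of_injective {u | R u v ∧ c u = j} (Prod.mk_left_injective false)]
    refine congrArg Set.ncard ?_
    ext ⟨u, b'⟩
    cases b' <;> simp [bipartiteCover]

end SimpleGraph

namespace Matrix

open SimpleGraph

variable {ι : Type u} (A : Matrix ι ι ℕ)

theorem exists_isPerfectColoring_of_mul_eq_mul [Fintype ι] [Nonempty ι] (w : ι → ℕ)
    (hpos : ∀ i, 0 < w i) (hw : ∀ i j, w i * A i j = w j * A j i) :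
    ∃ (V : Type u) (_ : Finite V) (_ : Nonempty V) (G : SimpleGraph V) (c : V → ι),
      G.IsPerfectColoring c A := by
  let φ (i j : ι) : Fin (w i) × Fin (A i j) ≃ Fin (w j) × Fin (A j i) :=
    Fintype.equivOfCardEq (by simpa using hw i j)
  let K : ℕ := ∑ i, ∑ j, A i j + 1
  have hK (i j : ι) : A i j < K := Nat.lt_succ_of_le <|
    (single_le_sum (f := fun j ↦ A i j) (fun _ _ ↦ Nat.zero_le _) (mem_univ j)).trans
      (single_le_sum (f := fun i ↦ ∑ j, A i j) (fun _ _ ↦ Nat.zero_le _) (mem_univ i))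
  have cast_inj {i j : ι} {r s : Fin (A i j)} (h : ((r : ℕ) : ZMod K) = (s : ℕ)) : r = s := by
    rw [ZMod.natCast_eq_natCast_iff] at h
    exact Fin.ext (h.eq_of_lt_of_lt (r.2.trans (hK i j)) (s.2.trans (hK i j)))
  let X := Σ i, Fin (w i) × ZMod K
  -- The label `r` separates parallel edges of the multigraph given by `φ`.
  let R (p q : X) : Prop :=
    ∃ r : Fin (A p.1 q.1), q.2 = ((φ p.1 q.1 (p.2.1, r)).1, p.2.2 + ((r : ℕ) : ZMod K))
  have : NeZero K := ⟨Nat.succ_ne_zero _⟩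
  refine ⟨X × Bool, inferInstance, ?_, bipartiteCover R, fun p ↦ p.1.1,
    isPerfectColoring_bipartiteCover (c := Sigma.fst) ?_ ?_⟩
  · obtain ⟨i⟩ := ‹Nonempty ι›
    exact ⟨⟨⟨i, ⟨0, hpos i⟩, 0⟩, false⟩⟩
  · rintro ⟨i, x, s⟩ j
    let f (r : Fin (A i j)) : X := ⟨j, (φ i j (x, r)).1, s + ((r : ℕ) : ZMod K)⟩
    have hf : f.Injective := fun r r' h ↦ by
      have h := (Prod.mk.inj (eq_of_heq (Sigma.mk.inj h).2)).2
      exact cast_inj (add_left_cancel h)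
    have : {u : X | R ⟨i, x, s⟩ u ∧ u.1 = j} = Set.range f := by
      ext ⟨k, y⟩
      constructor
      · rintro ⟨⟨r, hr⟩, rfl⟩
        exact ⟨r, by simp only [f]; rw [← hr]⟩
      · rintro ⟨r, hr⟩
        obtain ⟨rfl, h⟩ := Sigma.mk.inj hr
        exact ⟨⟨r, (eq_of_heq h).symm⟩, rfl⟩
    rw [this, ← Nat.card_coe_set_eq, Nat.card_range_of_injective hf, Nat.card_fin]
  · rintro ⟨j, y, s⟩ i
    let f (q : Fin (A j i)) : X :=
      ⟨i, ((φ i j).symm (y, q)).1, s - ((((φ i j).symm (y, q)).2 : ℕ) : ZMod K)⟩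
    have hf : f.Injective := fun q q' h ↦ by
      obtain ⟨h₁, h₂⟩ := Prod.mk.inj (eq_of_heq (Sigma.mk.inj h).2)
      exact (Prod.mk.inj ((φ i j).symm.injective (Prod.ext h₁ (cast_inj (sub_right_inj.1 h₂))))).2
    have : {u : X | R u ⟨j, y, s⟩ ∧ u.1 = i} = Set.range f := by
      ext ⟨k, x, s'⟩
      constructor
      · rintro ⟨⟨r, hr⟩, rfl⟩
        obtain ⟨h₁, h₂⟩ := Prod.mk.inj hr
        dsimp only at h₁ h₂
        have h : (φ k j).symm (y, (φ k j (x, r)).2) = (x, r) := by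
          rw [Equiv.symm_apply_eq, h₁]
        exact ⟨(φ k j (x, r)).2, by simp [f, h, h₂]⟩
      · rintro ⟨q, hq⟩
        obtain ⟨rfl, h⟩ := Sigma.mk.inj hq
        obtain ⟨rfl, rfl⟩ := Prod.mk.inj (eq_of_heq h)
        exact ⟨⟨((φ i j).symm (y, q)).2, by simp⟩, rfl⟩
    rw [this, ← Nat.card_coe_set_eq, Nat.card_range_of_injective hf, Nat.card_fin]

/-- The simple graph on the indices joining `i` and `j` if `A i j` or `A j i` is nonzero. -/
abbrev supportGraph : SimpleGraph ι := SimpleGraph.fromRel fun i j ↦ A i j ≠ 0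

variable {A}

theorem supportGraph_connected [Fintype ι] [DecidableEq ι] [Nonempty ι]
    (hirr : ¬ ∃ S : Finset ι, S.Nonempty ∧ Sᶜ.Nonempty ∧
      ∀ i ∈ S, ∀ j ∈ Sᶜ, A i j = 0 ∧ A j i = 0) : A.supportGraph.Connected := by
  classical
  refine ⟨fun u v ↦ ?_⟩
  by_contra huv
  refine hirr ⟨univ.filter (A.supportGraph.Reachable u), ⟨u, by simp⟩, ⟨v, by simpa using huv⟩,
    fun i hi j hj ↦ ?_⟩
  simp only [mem_compl, mem_filter, mem_univ, true_and] at hi hj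
  by_contra h
  refine hj (hi.trans (Adj.reachable ?_))
  rw [fromRel_adj]
  exact ⟨fun hij ↦ hj (hij ▸ hi), not_and_or.1 h⟩

theorem supportGraph_adj_ne_zero (hsym : ∀ i j, A i j = 0 ↔ A j i = 0) {i j : ι}
    (h : A.supportGraph.Adj i j) : A i j ≠ 0 := by
  rw [fromRel_adj] at h
  exact h.2.elim id fun hji ↦ (hsym i j).not.2 hji

variable (A) in
/-- The product of `A i j / A j i` over the darts `(i, j)` of a walk. -/
def walkRatio {G : SimpleGraph ι} : {u v : ι} → G.Walk u v → ℚ≥0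
  | _, _, .nil => 1
  | u, _, .cons (v := v) _ p => A u v / A v u * walkRatio p

theorem walkRatio_append {G : SimpleGraph ι} {u v w : ι} (p : G.Walk u v) (q : G.Walk v w) :
    A.walkRatio (p.append q) = A.walkRatio p * A.walkRatio q := by
  induction p with
  | nil => simp [walkRatio]
  | cons h p ih => simp [walkRatio, ih, mul_assoc]

theorem walkRatio_eq_prod {G : SimpleGraph ι} {u v : ι} (p : G.Walk u v) :
    A.walkRatio p = ∏ s ∈ range p.length,
      (A (p.getVert s) (p.getVert (s + 1)) / A (p.getVert (s + 1)) (p.getVert s) : ℚ≥0) := by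
  induction p with
  | nil => simp [walkRatio]
  | cons h p ih => simp [walkRatio, ih, prod_range_succ', mul_comm, div_mul_div_comm]

theorem walkRatio_pos (hsym : ∀ i j, A i j = 0 ↔ A j i = 0) {u v : ι}
    (p : A.supportGraph.Walk u v) : 0 < A.walkRatio p := by
  induction p with
  | nil => simp [walkRatio]
  | cons h p ih =>
    have h₁ := Nat.pos_of_ne_zero (supportGraph_adj_ne_zero hsym h)
    have h₂ := Nat.pos_of_ne_zero (supportGraph_adj_ne_zero hsym h.symm)
    rw [walkRatio]
    positivity

/-- The consistency condition: the products of the entries along any cycle of at least two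
distinct indices agree for both orientations. -/
def IsCycleConsistent (A : Matrix ι ι ℕ) : Prop :=
  ∀ t, 2 ≤ t → ∀ n : ℕ → ι, (∀ i < t, ∀ j < t, n i = n j → i = j) →
    (∏ s ∈ range (t - 1), A (n s) (n (s + 1))) * A (n (t - 1)) (n 0)
      = (∏ s ∈ range (t - 1), A (n (s + 1)) (n s)) * A (n 0) (n (t - 1))

theorem isCycleConsistent_of_mul_eq_mul {w : ι → ℕ} (hpos : ∀ i, 0 < w i)
    (hw : ∀ i j, w i * A i j = w j * A j i) : A.IsCycleConsistent := by
  intro t ht n _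
  obtain ⟨t, rfl⟩ : ∃ k, t = k + 1 := ⟨t - 1, by omega⟩
  simp only [Nat.add_sub_cancel]
  refine Nat.eq_of_mul_eq_mul_left (prod_pos fun s (_ : s ∈ range (t + 1)) ↦ hpos (n s)) ?_
  calc
    _ = (∏ s ∈ range t, w (n s) * A (n s) (n (s + 1))) * (w (n t) * A (n t) (n 0)) := by
      rw [prod_range_succ, prod_mul_distrib]
      ring
    _ = (∏ s ∈ range t, w (n (s + 1)) * A (n (s + 1)) (n s)) * (w (n 0) * A (n 0) (n t)) := by
      simp_rw [hw]
    _ = _ := by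
      rw [prod_range_succ', prod_mul_distrib]
      ring

namespace IsCycleConsistent

theorem walkRatio_cons_isPath (hA : A.IsCycleConsistent) (hsym : ∀ i j, A i j = 0 ↔ A j i = 0)
    {u v : ι} (h : A.supportGraph.Adj u v)
    {p : A.supportGraph.Walk v u} (hp : p.IsPath) : A.walkRatio (.cons h p) = 1 := by
  have hlen : p.length ≠ 0 := fun h0 ↦ h.ne (Walk.eq_of_length_eq_zero h0).symm
  have key := hA (p.length + 1) (by omega) p.getVert fun i hi j hj hij ↦
    hp.getVert_injOn (Nat.lt_succ_iff.1 hi) (Nat.lt_succ_iff.1 hj) hij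
  simp only [Nat.add_sub_cancel, Walk.getVert_length, Walk.getVert_zero] at key
  rw [walkRatio, walkRatio_eq_prod, prod_div_distrib, div_mul_div_comm, div_eq_one_iff_eq]
  · rw [mul_comm, mul_comm (A v u : ℚ≥0)]
    exact_mod_cast key
  · refine mul_ne_zero (Nat.cast_ne_zero.2 (supportGraph_adj_ne_zero hsym h.symm))
      (prod_ne_zero_iff.2 fun s hs ↦ Nat.cast_ne_zero.2 (supportGraph_adj_ne_zero hsym ?_))
    exact (p.adj_getVert_succ (mem_range.1 hs)).symm

theorem walkRatio_bypass (hA : A.IsCycleConsistent) (hsym : ∀ i j, A i j = 0 ↔ A j i = 0)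
    [DecidableEq ι] {u v : ι} (p : A.supportGraph.Walk u v) :
    A.walkRatio p.bypass = A.walkRatio p := by
  induction p with
  | nil => rfl
  | @cons u v w h p ih =>
    rw [Walk.bypass]
    split_ifs with hu
    · have hcycle := hA.walkRatio_cons_isPath hsym h (p.bypass_isPath.takeUntil hu)
      have hsplit := congrArg A.walkRatio (p.bypass.take_spec hu)
      rw [walkRatio_append] at hsplit
      rw [walkRatio] at hcycle ⊢
      rw [← ih, ← hsplit, ← mul_assoc, hcycle, one_mul]
    · rw [walkRatio, walkRatio, ih]

theorem walkRatio_closed (hA : A.IsCycleConsistent) (hsym : ∀ i j, A i j = 0 ↔ A j i = 0)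
    {u : ι} (p : A.supportGraph.Walk u u) : A.walkRatio p = 1 := by
  classical
  rw [← hA.walkRatio_bypass hsym,
    Walk.eq_nil_iff_nil.2 (Walk.isPath_iff_nil.1 p.bypass_isPath), walkRatio]

theorem exists_weight (hA : A.IsCycleConsistent) (hsym : ∀ i j, A i j = 0 ↔ A j i = 0)
    [Fintype ι] (hconn : A.supportGraph.Connected) :
    ∃ w : ι → ℕ, (∀ i, 0 < w i) ∧ ∀ i j, w i * A i j = w j * A j i := by
  obtain ⟨r⟩ := hconn.nonempty
  let p (i : ι) : A.supportGraph.Walk r i := (hconn.preconnected r i).some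
  let q (i : ι) : ℚ≥0 := A.walkRatio (p i)
  have hq (i j : ι) : q i * A i j = q j * A j i := by
    by_cases hij : i = j
    · rw [hij]
    by_cases h0 : A i j = 0
    · simp [h0, (hsym i j).1 h0]
    have h0' : (A j i : ℚ≥0) ≠ 0 := Nat.cast_ne_zero.2 ((hsym i j).not.1 h0)
    have hadj : A.supportGraph.Adj i j := (fromRel_adj _ _ _).2 ⟨hij, .inl h0⟩
    have h₁ := hA.walkRatio_closed hsym ((p i).append (.cons hadj (p j).reverse))
    have h₂ := hA.walkRatio_closed hsym ((p j).append (p j).reverse)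
    rw [walkRatio_append] at h₁ h₂
    rw [walkRatio, ← mul_assoc] at h₁
    have := mul_right_cancel₀ (walkRatio_pos hsym (p j).reverse).ne' (h₁.trans h₂.symm)
    rw [← mul_div_assoc, div_eq_iff h0'] at this
    exact this
  have hint (i : ι) : ∃ n : ℕ, (n : ℚ≥0) = (∏ k, (q k).den : ℕ) * q i := by
    obtain ⟨c, hc⟩ := dvd_prod_of_mem (fun k ↦ (q k).den) (mem_univ i)
    refine ⟨c * (q i).num, ?_⟩
    rw [hc]
    push_cast
    rw [← NNRat.mul_den_eq_num]
    ring
  choose w hw using hint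
  have hD : 0 < ∏ k, (q k).den := prod_pos fun k _ ↦ (q k).den_pos
  refine ⟨w, fun i ↦ ?_, fun i j ↦ ?_⟩
  · rw [← Nat.cast_pos (α := ℚ≥0), hw]
    exact mul_pos (Nat.cast_pos.2 hD) (walkRatio_pos hsym (p i))
  · rw [← Nat.cast_inj (R := ℚ≥0)]
    push_cast [hw]
    rw [mul_assoc, mul_assoc, hq]

end IsCycleConsistent

end Matrix

namespace SimpleGraph.IsPerfectColoring

variable {V ι : Type*} {G : SimpleGraph V} {c : V → ι} {A : Matrix ι ι ℕ}

theorem eq_zero_comm [Finite V] (h : G.IsPerfectColoring c A) (hc : c.Surjective) (i j : ι) :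
    A i j = 0 ↔ A j i = 0 := by
  have key (i j : ι) (hij : A i j ≠ 0) : A j i ≠ 0 := by
    obtain ⟨v, rfl⟩ := hc i
    obtain ⟨u, hu, rfl⟩ := h.exists_adj.1 hij
    exact h.exists_adj.2 ⟨v, hu.symm, rfl⟩
  exact not_iff_not.1 ⟨key i j, key j i⟩

theorem isCycleConsistent [Finite V] (h : G.IsPerfectColoring c A) (hc : c.Surjective) :
    A.IsCycleConsistent := by
  classical
  cases nonempty_fintype V
  refine Matrix.isCycleConsistent_of_mul_eq_mul (fun i ↦ ?_) h.card_mul_eq_card_mul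
  obtain ⟨v, rfl⟩ := hc i
  exact card_pos.2 ⟨v, by simp⟩

theorem mem_of_connected [Finite V] (h : G.IsPerfectColoring c A) (hG : G.Connected) {S : Set ι}
    (hS : ∀ i ∈ S, ∀ j ∉ S, A i j = 0) {u : V} (hu : c u ∈ S) (v : V) : c v ∈ S := by
  obtain ⟨p⟩ := hG.preconnected u v
  induction p with
  | nil => exact hu
  | cons hadj p ih =>
    refine ih ?_
    by_contra hv
    exact h.exists_adj.2 ⟨_, hadj, rfl⟩ (hS _ hu _ hv)

theorem irreducible [Finite V] [Fintype ι] [DecidableEq ι] (h : G.IsPerfectColoring c A)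
    (hc : c.Surjective) (hG : G.Connected) :
    ¬ ∃ S : Finset ι, S.Nonempty ∧ Sᶜ.Nonempty ∧
      ∀ i ∈ S, ∀ j ∈ Sᶜ, A i j = 0 ∧ A j i = 0 := by
  rintro ⟨S, ⟨i, hi⟩, ⟨j, hj⟩, hS⟩
  obtain ⟨u, rfl⟩ := hc i
  obtain ⟨v, rfl⟩ := hc j
  exact mem_compl.1 hj <| h.mem_of_connected hG (S := S)
    (fun i hi j hj ↦ (hS i hi j (mem_compl.2 hj)).1) hi v

theorem surjective_of_irreducible [Finite V] [Nonempty V] [Fintype ι] [DecidableEq ι]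
    (h : G.IsPerfectColoring c A) (hsym : ∀ i j, A i j = 0 ↔ A j i = 0)
    (hirr : ¬ ∃ S : Finset ι, S.Nonempty ∧ Sᶜ.Nonempty ∧
      ∀ i ∈ S, ∀ j ∈ Sᶜ, A i j = 0 ∧ A j i = 0) : c.Surjective := by
  classical
  obtain ⟨v⟩ := ‹Nonempty V›
  by_contra hc
  obtain ⟨j, hj⟩ := not_forall.1 hc
  refine hirr ⟨univ.filter (· ∈ Set.range c), ⟨c v, by simp⟩, ⟨j, by simpa using hj⟩,
    fun i hi k hk ↦ ?_⟩
  simp only [mem_compl, mem_filter, mem_univ, true_and] at hi hk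
  obtain ⟨u, rfl⟩ := hi
  rw [hsym k, and_self]
  by_contra h0
  obtain ⟨x, -, hx⟩ := h.exists_adj.1 h0
  exact hk ⟨x, hx⟩

end SimpleGraph.IsPerfectColoring


/-- A matrix `A ∈ ℕ^{m×m}` is the color adjacency matrix of a
perfect `m`-coloring of some finite *connected* simple graph if and only if it
is weakly symmetric, satisfies the consistency condition, and is irreducible
(there is no partition of the index set into two nonempty parts `S`, `Sᶜ` with
`A i j = 0` for all `i ∈ S, j ∈ Sᶜ` and all `i ∈ Sᶜ, j ∈ S`). -/
theorem stmt_5 (m : ℕ) (hm : 0 < m) (A : Matrix (Fin m) (Fin m) ℕ) :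
    (∃ (N : ℕ) (G : SimpleGraph (Fin N)), G.Connected ∧
      ∃ c : Fin N → Fin m, Function.Surjective c ∧
        ∀ (v : Fin N) (j : Fin m), Nat.card {u | G.Adj v u ∧ c u = j} = A (c v) j)
    ↔ ((∀ i j, A i j = 0 ↔ A j i = 0) ∧
       (∀ t, 2 ≤ t → ∀ n : ℕ → Fin m, (∀ i < t, ∀ j < t, n i = n j → i = j) →
         (∏ s ∈ Finset.range (t - 1), A (n s) (n (s + 1))) * A (n (t - 1)) (n 0)
           = (∏ s ∈ Finset.range (t - 1), A (n (s + 1)) (n s)) * A (n 0) (n (t - 1))) ∧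
       ¬ ∃ S : Finset (Fin m), S.Nonempty ∧ Sᶜ.Nonempty ∧
         ∀ i ∈ S, ∀ j ∈ Sᶜ, A i j = 0 ∧ A j i = 0) := by
  have : Nonempty (Fin m) := ⟨⟨0, hm⟩⟩
  constructor
  · rintro ⟨N, G, hG, c, hc, h⟩
    replace h : G.IsPerfectColoring c A := h
    exact ⟨h.eq_zero_comm hc, h.isCycleConsistent hc, h.irreducible hc hG⟩
  · rintro ⟨hsym, hA, hirr⟩
    obtain ⟨w, hpos, hw⟩ := Matrix.IsCycleConsistent.exists_weight hA hsym
      (Matrix.supportGraph_connected hirr)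
    obtain ⟨V, _, ⟨v⟩, G, c, h⟩ := A.exists_isPerfectColoring_of_mul_eq_mul w hpos hw
    let C := G.connectedComponentMk v
    obtain ⟨N, ⟨e⟩⟩ := Finite.exists_equiv_fin C
    let f : C.toSimpleGraph.comap e.symm ≃g C.toSimpleGraph := SimpleGraph.Iso.comap e.symm _
    have hf := (h.restrict_connectedComponent C).comap_iso f
    have hconn := f.connected_iff.2 C.connected_toSimpleGraph
    have := hconn.nonempty
    exact ⟨N, _, hconn, _, hf.surjective_of_irreducible hsym hirr, hf⟩
end

section
/- Let G = (V,E) be a finite connected simple graph with a perfect 3-coloring having color adjacency matrix A = (a_{ij}) ∈ ℕ^{3×3}, and let v_i denote the number of vertices of color i. Then there is a permutation (n_1, n_2, n_3) of (1, 2, 3) such that a_{n_1,n_2} · a_{n_1,n_3} ≠ 0, and for any such permutation: v_{n_1} · (a_{n_2,n_1} a_{n_3,n_1} + a_{n_1,n_2} a_{n_3,n_1} + a_{n_1,n_3} a_{n_2,n_1}) = a_{n_2,n_1} a_{n_3,n_1} · |V|, v_{n_2} · (a_{n_2,n_1} a_{n_3,n_1} + a_{n_1,n_2} a_{n_3,n_1}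 + a_{n_2,n_1} a_{n_1,n_3}) = a_{n_1,n_2} a_{n_3,n_1} · |V|, and v_{n_3} · (a_{n_3,n_1} a_{n_2,n_1} + a_{n_3,n_1} a_{n_1,n_2} + a_{n_1,n_3} a_{n_2,n_1}) = a_{n_1,n_3} a_{n_2,n_1} · |V|. -/
/-- Double counting of the edges between two color classes of a perfect coloring. -/
theorem card_colorClass_mul_comm {V ι : Type*} [Fintype V] (G : SimpleGraph V)
    (c : V → ι) (A : Matrix ι ι ℕ)
    (hperf : ∀ (v : V) (j : ι), Nat.card {u | G.Adj v u ∧ c u = j} = A (c v) j) (i j : ι) :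
    Nat.card {v | c v = i} * A i j = Nat.card {v | c v = j} * A j i := by
  classical
  have hcard (p : V → Prop) : Nat.card {v | p v} = (Finset.univ.filter p).card := by
    exact (Nat.card_eq_fintype_card (α := {v // p v})).trans (Fintype.card_subtype p)
  rw [hcard, hcard]
  refine Finset.card_mul_eq_card_mul G.Adj (fun v hv => ?_) (fun u hu => ?_)
  · have hv : c v = i := by simpa using hv
    rw [← hv, ← hperf, hcard, Finset.bipartiteAbove, Finset.filter_filter]
    simp only [and_comm]
  · have hu : c u = j := by simpa using hu
    rw [← hu, ← hperf, hcard, Finset.bipartiteBelow, Finset.filter_filter]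
    simp only [and_comm, G.adj_comm u]

/-- In a perfect coloring of a connected graph with at least two colors, every color is adjacent
to some other color. -/
theorem exists_ne_colorMatrix_ne_zero {V ι : Type*} [Finite V] [Nontrivial ι]
    (G : SimpleGraph V) (hG : G.Connected) (c : V → ι) (hc : Function.Surjective c)
    (A : Matrix ι ι ℕ)
    (hperf : ∀ (v : V) (j : ι), Nat.card {u | G.Adj v u ∧ c u = j} = A (c v) j) (i : ι) :
    ∃ j, j ≠ i ∧ A i j ≠ 0 := by
  by_contra! h
  have step (v u : V) (hvu : G.Adj v u) (hv : c v = i) : c u = i := by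
    by_contra hu
    have h0 := hperf v (c u)
    rw [hv, h _ hu] at h0
    have : Nonempty {w | G.Adj v w ∧ c w = c u} := ⟨⟨u, hvu, rfl⟩⟩
    exact Nat.card_pos.ne' h0
  have walk (v u : V) (p : G.Walk v u) : c v = i → c u = i := by
    induction p with
    | nil => exact id
    | cons hvw _ ih => exact fun hv => ih (step _ _ hvw hv)
  obtain ⟨j, hj⟩ := exists_ne i
  obtain ⟨v, hv⟩ := hc i
  obtain ⟨u, hu⟩ := hc j
  obtain ⟨p⟩ := hG.preconnected v u
  exact hj (hu ▸ walk v u p hv)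

/-- A symmetric relation on three points without isolated points has a point related to both
others. -/
theorem exists_perm_fin_three_of_symm (r : Fin 3 → Fin 3 → Prop)
    (hsymm : ∀ i j, r i j → r j i) (h : ∀ i, ∃ j, j ≠ i ∧ r i j) :
    ∃ σ : Equiv.Perm (Fin 3), r (σ 0) (σ 1) ∧ r (σ 0) (σ 2) := by
  by_cases h01 : r 0 1
  · obtain ⟨j, hj, hr⟩ := h 2
    fin_cases j
    · exact ⟨1, h01, hsymm _ _ hr⟩
    · exact ⟨Equiv.swap 0 1, hsymm _ _ h01, hsymm _ _ hr⟩
    · exact absurd rfl hj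
  · have h02 : r 0 2 := by
      obtain ⟨j, hj, hr⟩ := h 0
      fin_cases j
      · exact absurd rfl hj
      · exact absurd hr h01
      · exact hr
    have h12 : r 1 2 := by
      obtain ⟨j, hj, hr⟩ := h 1
      fin_cases j
      · exact absurd (hsymm _ _ hr) h01
      · exact absurd rfl hj
      · exact hr
    exact ⟨Equiv.swap 0 2, hsymm _ _ h12, hsymm _ _ h02⟩


/-- For a perfect 3-coloring of a finite connected simple graph,
there is a permutation `(n₁,n₂,n₃)` of the colors with `a_{n₁n₂}·a_{n₁n₃} ≠ 0`,
and for any such permutation the stated counting identities for `v_{n₁}`,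
`v_{n₂}`, `v_{n₃}` hold. -/
theorem stmt_11 {V : Type*} [Fintype V] (G : SimpleGraph V) (hG : G.Connected)
    (c : V → Fin 3) (hc : Function.Surjective c)
    (A : Matrix (Fin 3) (Fin 3) ℕ)
    (hperf : ∀ (v : V) (j : Fin 3), Nat.card {u | G.Adj v u ∧ c u = j} = A (c v) j) :
    (∃ σ : Equiv.Perm (Fin 3), A (σ 0) (σ 1) * A (σ 0) (σ 2) ≠ 0) ∧
    ∀ σ : Equiv.Perm (Fin 3), A (σ 0) (σ 1) * A (σ 0) (σ 2) ≠ 0 →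
      Nat.card {v | c v = σ 0} *
          (A (σ 1) (σ 0) * A (σ 2) (σ 0) + A (σ 0) (σ 1) * A (σ 2) (σ 0)
            + A (σ 0) (σ 2) * A (σ 1) (σ 0))
        = A (σ 1) (σ 0) * A (σ 2) (σ 0) * Fintype.card V ∧
      Nat.card {v | c v = σ 1} *
          (A (σ 1) (σ 0) * A (σ 2) (σ 0) + A (σ 0) (σ 1) * A (σ 2) (σ 0)
            + A (σ 1) (σ 0) * A (σ 0) (σ 2))
        = A (σ 0) (σ 1) * A (σ 2) (σ 0) * Fintype.card V ∧
      Nat.card {v | c v = σ 2} *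
          (A (σ 2) (σ 0) * A (σ 1) (σ 0) + A (σ 2) (σ 0) * A (σ 0) (σ 1)
            + A (σ 0) (σ 2) * A (σ 1) (σ 0))
        = A (σ 0) (σ 2) * A (σ 1) (σ 0) * Fintype.card V := by
  have hbal := card_colorClass_mul_comm G c A hperf
  have hpos (i : Fin 3) : Nat.card {v | c v = i} ≠ 0 := by
    obtain ⟨v, hv⟩ := hc i
    have : Nonempty {v | c v = i} := ⟨⟨v, hv⟩⟩
    exact Nat.card_pos.ne'
  refine ⟨?_, fun σ _ => ?_⟩
  · obtain ⟨σ, h1, h2⟩ := exists_perm_fin_three_of_symm (fun i j => A i j ≠ 0)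
      (fun i j hij hji => mul_ne_zero (hpos i) hij (by rw [hbal, hji, mul_zero]))
      (exists_ne_colorMatrix_ne_zero G hG c hc A hperf)
    exact ⟨σ, mul_ne_zero h1 h2⟩
  · have hsum : Fintype.card V = Nat.card {v | c v = σ 0} + Nat.card {v | c v = σ 1}
        + Nat.card {v | c v = σ 2} := by
      rw [← Fin.sum_univ_three (fun i => Nat.card {v | c v = σ i}),
        Equiv.sum_comp σ (fun i => Nat.card {v | c v = i}), ← Nat.card_eq_fintype_card,
        ← Nat.card_congr (Equiv.sigmaFiberEquiv c), Nat.card_sigma]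
      rfl
    have h01 := hbal (σ 0) (σ 1)
    have h02 := hbal (σ 0) (σ 2)
    rw [hsum]
    generalize Nat.card {v | c v = σ 0} = x, Nat.card {v | c v = σ 1} = y,
      Nat.card {v | c v = σ 2} = z at *
    zify at h01 h02 ⊢
    refine ⟨?_, ?_, ?_⟩
    · linear_combination (A (σ 2) (σ 0) : ℤ) * h01 + (A (σ 1) (σ 0) : ℤ) * h02
    · linear_combination -((A (σ 2) (σ 0) : ℤ) + A (σ 0) (σ 2)) * h01 + (A (σ 0) (σ 1) : ℤ) * h02
    · linear_combination -((A (σ 1) (σ 0) : ℤ) + A (σ 0) (σ 1)) * h02 + (A (σ 0) (σ 2) : ℤ) * h01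
end

section
/- Let G be a finite simple graph with adjacency matrix M (a 0–1 matrix over the integers), and suppose G has a perfect m-coloring with color adjacency matrix A ∈ ℕ^{m×m}. Then the characteristic polynomial of A divides the characteristic polynomial of M (in ℤ[x]). In particular, every eigenvalue of A is an eigenvalue of M. -/
open Matrix Polynomial in
/-- If a block matrix `M` satisfies `M * S = S * A` for `S = fromRows 1 T`, then the
characteristic polynomial of `A` divides that of `M`. -/
theorem Matrix.charpoly_dvd_charpoly_fromBlocks {k l R : Type*} [CommRing R]
    [Fintype k] [DecidableEq k] [Fintype l] [DecidableEq l]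
    (A P : Matrix k k R) (Q : Matrix k l R) (L : Matrix l k R) (N : Matrix l l R)
    (T : Matrix l k R) (hA : P + Q * T = A) (hT : L + N * T = T * A) :
    A.charpoly ∣ (fromBlocks P Q L N).charpoly := by
  have hM : fromBlocks P Q L N =
      fromBlocks 1 0 T 1 * fromBlocks A Q 0 (N - T * Q) * fromBlocks 1 0 (-T) 1 := by
    have hP : P = A - Q * T := eq_sub_of_add_eq hA
    have hL : L = T * A - N * T := eq_sub_of_add_eq hT
    rw [hP, hL]
    simp only [fromBlocks_multiply, Matrix.one_mul, Matrix.mul_one, Matrix.zero_mul,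
      Matrix.mul_zero, Matrix.mul_neg, Matrix.add_mul, Matrix.sub_mul, Matrix.mul_assoc]
    congr 1 <;> abel
  have hU : (fromBlocks 1 0 (-T) 1 * fromBlocks 1 0 T 1 : Matrix (k ⊕ l) (k ⊕ l) R) = 1 := by
    simp [fromBlocks_multiply]
  rw [hM, charpoly_mul_comm, ← Matrix.mul_assoc, hU, Matrix.one_mul, charpoly_fromBlocks_zero₂₁]
  exact dvd_mul_right _ _

open Matrix in
/-- If `M * S = S * A` and some rows of `S` form the identity matrix, then the characteristic
polynomial of `A` divides that of `M`. -/
theorem Matrix.charpoly_dvd_charpoly_of_mul_eq_mul {k n R : Type*} [CommRing R]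
    [Fintype k] [DecidableEq k] [Fintype n] [DecidableEq n]
    (M : Matrix n n R) (A : Matrix k k R) (S : Matrix n k R) (h : M * S = S * A)
    (s : k ↪ n) (hs : S.submatrix s id = 1) : A.charpoly ∣ M.charpoly := by
  classical
  let e : k ⊕ ((Set.range s)ᶜ : Set n) ≃ n :=
    ((Equiv.ofInjective s s.injective).sumCongr (Equiv.refl _)).trans
      (Equiv.Set.sumCompl (Set.range s))
  have hS : S.submatrix e id = fromRows 1 (S.submatrix e id).toRows₂ := by
    rw [← hs]
    exact (fromRows_toRows _).symm
  have h' : M.submatrix e e * S.submatrix e id = S.submatrix e id * A := by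
    rw [submatrix_mul_equiv, h]
    rfl
  rw [← charpoly_reindex e.symm M, reindex_apply, Equiv.symm_symm,
    ← fromBlocks_toBlocks (M.submatrix e e)]
  rw [hS, ← fromBlocks_toBlocks (M.submatrix e e), fromBlocks_mul_fromRows, fromRows_mul,
    fromRows_ext_iff, Matrix.mul_one, Matrix.mul_one, Matrix.one_mul] at h'
  exact charpoly_dvd_charpoly_fromBlocks _ _ _ _ _ _ h'.1 h'.2

/-- The characteristic polynomial of the color adjacency matrix
of a perfect coloring divides the characteristic polynomial of the adjacency
matrix of the graph (over ℤ); in particular every (complex) root of the former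
is a root of the latter. -/
theorem stmt_15 {V : Type*} [Fintype V] [DecidableEq V]
    (G : SimpleGraph V) [DecidableRel G.Adj]
    (m : ℕ) (c : V → Fin m) (hc : Function.Surjective c)
    (A : Matrix (Fin m) (Fin m) ℕ)
    (hperf : ∀ (v : V) (j : Fin m), Nat.card {u | G.Adj v u ∧ c u = j} = A (c v) j) :
    (A.map (Nat.cast : ℕ → ℤ)).charpoly ∣ (G.adjMatrix ℤ).charpoly ∧
    ∀ z : ℂ, Polynomial.aeval z (A.map (Nat.cast : ℕ → ℤ)).charpoly = 0 →
      Polynomial.aeval z (G.adjMatrix ℤ).charpoly = 0 := by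
  have hdvd : (A.map (Nat.cast : ℕ → ℤ)).charpoly ∣ (G.adjMatrix ℤ).charpoly := by
    refine Matrix.charpoly_dvd_charpoly_of_mul_eq_mul _ _
      (Matrix.of fun v j => if c v = j then 1 else 0) ?_
      ⟨Function.surjInv hc, Function.injective_surjInv hc⟩ ?_
    · ext v j
      have hcard : ((Finset.univ.filter fun u => G.Adj v u ∧ c u = j).card : ℤ) = A (c v) j := by
        rw [← hperf v j, Nat.card_eq_fintype_card, Fintype.card_subtype]
        rfl
      simp [Matrix.mul_apply, ← hcard, SimpleGraph.adjMatrix_apply, ← ite_and, and_comm]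
    · ext i j
      simp [Matrix.one_apply, Function.surjInv_eq hc]
  refine ⟨hdvd, fun z hz => ?_⟩
  exact Polynomial.aeval_eq_zero_of_dvd_aeval_eq_zero hdvd hz
end
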